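/- Let p_0, p_1, p_2 be three affinely independent points in ℝ², λ ∈ (0,1), f_j(x) = λx + (1−λ)p_j, and let λ_0 be the unique positive real root of x³ + x = 1. If λ < λ_0, then the point x = (λ⁻¹ − 1)·∑_{n=1}^∞ λ^n p_{i_n}, where (i_1, i_2, i_3, i_4, …) is the periodic sequence (2,1,0,2,1,0,…) (i.e., i_{3k+1} = 2, i_{3k+2} = 1, i_{3k+3} = 0 for all k ≥ 0), has a unique address: the only sequence (j_n) ∈ {0,1,2}^ℕ with x = (λ⁻¹ − 1)·∑_{n=1}^∞ λ^n p_{j_n} is (i_n) itself. -/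

import Mathlib

/-- The mass that the sequence `q` gives to the digit `k`, with weights `lam ^ n`. -/
noncomputable def digitSum (lam : ℝ) (q : ℕ → Fin 3) (k : Fin 3) : ℝ :=
  ∑' n : ℕ, if q n = k then lam ^ n else 0

lemma summable_digit {lam : ℝ} (h0 : 0 < lam) (h1 : lam < 1)
    (q : ℕ → Fin 3) (k : Fin 3) :
    Summable fun n : ℕ => if q n = k then lam ^ n else 0 := by
  refine Summable.of_nonneg_of_le (fun n => ?_) (fun n => ?_)
    (summable_geometric_of_lt_one h0.le h1)
  · split_ifs <;> positivity
  · split_ifs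
    · exact le_rfl
    · positivity

lemma digitSum_nonneg {lam : ℝ} (h0 : 0 < lam)
    (q : ℕ → Fin 3) (k : Fin 3) : 0 ≤ digitSum lam q k :=
  tsum_nonneg fun n => by split_ifs <;> positivity

lemma digitSum_eq_add_shift {lam : ℝ} (h0 : 0 < lam) (h1 : lam < 1)
    (q : ℕ → Fin 3) (k : Fin 3) :
    digitSum lam q k =
      (if q 0 = k then 1 else 0) + lam * digitSum lam (fun n => q (n + 1)) k := by
  unfold digitSum
  rw [(summable_digit h0 h1 q k).tsum_eq_zero_add, ← tsum_mul_left]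
  simp only [pow_zero, mul_ite, mul_zero, pow_succ']

lemma sum_digitSum {lam : ℝ} (h0 : 0 < lam) (h1 : lam < 1)
    (q : ℕ → Fin 3) : ∑ k, digitSum lam q k = ∑' n : ℕ, lam ^ n := by
  unfold digitSum
  rw [← Summable.tsum_finsetSum fun k _ => summable_digit h0 h1 q k]
  simp

lemma tsum_smul_eq_sum_digitSum {lam : ℝ} (h0 : 0 < lam) (h1 : lam < 1)
    {E : Type*} [NormedAddCommGroup E] [NormedSpace ℝ E]
    (p : Fin 3 → E) (q : ℕ → Fin 3) :
    ∑' n : ℕ, lam ^ (n + 1) • p (q n) = lam • ∑ k, digitSum lam q k • p k := by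
  have h : HasSum (fun n : ℕ => lam • ∑ k, (if q n = k then lam ^ n else 0) • p k)
      (lam • ∑ k, digitSum lam q k • p k) :=
    (hasSum_sum fun k _ => (summable_digit h0 h1 q k).hasSum.smul_const (p k)).const_smul lam
  rw [← h.tsum_eq]
  refine tsum_congr fun n => ?_
  simp [ite_smul, pow_succ', mul_smul]

lemma digitSum_eq_of_tsum_smul_eq {lam : ℝ} (h0 : 0 < lam) (h1 : lam < 1)
    {E : Type*} [NormedAddCommGroup E] [NormedSpace ℝ E]
    {p : Fin 3 → E} (hp : AffineIndependent ℝ p) {q r : ℕ → Fin 3}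
    (h : ∑' n : ℕ, lam ^ (n + 1) • p (q n) = ∑' n : ℕ, lam ^ (n + 1) • p (r n)) (k : Fin 3) :
    digitSum lam q k = digitSum lam r k := by
  rw [tsum_smul_eq_sum_digitSum h0 h1, tsum_smul_eq_sum_digitSum h0 h1] at h
  have h' := smul_right_injective E h0.ne' h
  refine sub_eq_zero.1 (affineIndependent_iff.1 hp Finset.univ
    (fun k => digitSum lam q k - digitSum lam r k) ?_ ?_ k (Finset.mem_univ k))
  · rw [Finset.sum_sub_distrib, sum_digitSum h0 h1, sum_digitSum h0 h1, sub_self]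
  · simp only [sub_smul, Finset.sum_sub_distrib]
    exact sub_eq_zero.2 h'

lemma digitSum_lt_one_of_periodic {lam : ℝ} (h0 : 0 < lam) (h1 : lam < 1)
    (hlam : lam ^ 3 + lam < 1) {s : ℕ → Fin 3}
    (hs : ∀ n, s (n + 3) = s n) (h12 : s 1 ≠ s 2) {k : Fin 3} (hk : s 0 ≠ k) :
    digitSum lam s k < 1 := by
  have e0 := digitSum_eq_add_shift h0 h1 s k
  have e1 := digitSum_eq_add_shift h0 h1 (fun n => s (n + 1)) k
  have e2 := digitSum_eq_add_shift h0 h1 (fun n => s (n + 2)) k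
  simp only [add_assoc, Nat.reduceAdd, zero_add, hs] at e0 e1 e2
  rw [if_neg hk] at e0
  by_contra! hS
  have h3 : lam ^ 3 ≤ 1 := pow_le_one₀ h0.le h1.le
  have key : digitSum lam s k * (1 - lam ^ 3) ≤ lam := by
    rw [e2] at e1
    rw [e1] at e0
    split_ifs at e0 with ha hb
    · exact absurd (ha.trans hb.symm) h12
    all_goals nlinarith
  nlinarith

lemma head_eq_of_digitSum_eq_periodic {lam : ℝ} (h0 : 0 < lam) (h1 : lam < 1)
    (hlam : lam ^ 3 + lam < 1) {s j : ℕ → Fin 3}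
    (hs : ∀ n, s (n + 3) = s n) (h12 : s 1 ≠ s 2)
    (h : ∀ k, digitSum lam s k = digitSum lam j k) : j 0 = s 0 := by
  by_contra hne
  have hlt := digitSum_lt_one_of_periodic h0 h1 hlam hs h12 (Ne.symm hne)
  rw [h, digitSum_eq_add_shift h0 h1, if_pos rfl] at hlt
  have := mul_nonneg h0.le (digitSum_nonneg h0 (fun n => j (n + 1)) (j 0))
  linarith

lemma eq_of_digitSum_eq_periodic {lam : ℝ} (h0 : 0 < lam) (h1 : lam < 1)
    (hlam : lam ^ 3 + lam < 1) (n : ℕ) :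
    ∀ s j : ℕ → Fin 3, (∀ n, s (n + 3) = s n) → s 0 ≠ s 1 → s 1 ≠ s 2 → s 2 ≠ s 0 →
      (∀ k, digitSum lam s k = digitSum lam j k) → j n = s n := by
  induction n with
  | zero =>
    intro s j hs _ h12 _ h
    exact head_eq_of_digitSum_eq_periodic h0 h1 hlam hs h12 h
  | succ n ih =>
    intro s j hs h01 h12 h20 h
    have hj : j 0 = s 0 := head_eq_of_digitSum_eq_periodic h0 h1 hlam hs h12 h
    refine ih (fun n => s (n + 1)) (fun n => j (n + 1)) (fun n => hs (n + 1)) h12 ?_ ?_ ?_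
    · simpa [hs 0] using h20
    · simpa [hs 0] using h01
    · intro k
      have hk := h k
      rw [digitSum_eq_add_shift h0 h1 s, digitSum_eq_add_shift h0 h1 j, hj] at hk
      exact mul_left_cancel₀ h0.ne' (add_left_cancel hk)

/-- Triangular case: if `λ < λ_0` (the unique positive root of `x³ + x = 1`),
then the point whose address is the periodic sequence `(2,1,0,2,1,0,…)` has a
unique address: no other sequence in `{0,1,2}^ℕ` represents it. -/
theorem stmt18 (p : Fin 3 → EuclideanSpace ℝ (Fin 2)) (hp : AffineIndependent ℝ p)
    (lam0 : ℝ) (hlam0pos : 0 < lam0) (hroot : lam0 ^ 3 + lam0 = 1)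
    (lam : ℝ) (h0 : 0 < lam) (h1 : lam < lam0)
    (seq : ℕ → Fin 3) (hseq : ∀ n, seq n = ⟨2 - n % 3, by omega⟩) :
    ∀ j : ℕ → Fin 3,
      (lam⁻¹ - 1) • ∑' n : ℕ, lam ^ (n + 1) • p (seq n) =
        (lam⁻¹ - 1) • ∑' n : ℕ, lam ^ (n + 1) • p (j n) → j = seq := by
  intro j hj
  have hl1 : lam0 < 1 := by nlinarith [pow_pos hlam0pos 3]
  have hlt : lam < 1 := h1.trans hl1
  have hlam : lam ^ 3 + lam < 1 := by
    have : lam ^ 3 < lam0 ^ 3 := pow_lt_pow_left₀ h1 h0.le (by norm_num)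
    linarith
  have hne : lam⁻¹ - 1 ≠ 0 := (sub_pos.2 ((one_lt_inv₀ h0).2 hlt)).ne'
  have hsum := smul_right_injective _ hne hj
  funext n
  exact eq_of_digitSum_eq_periodic h0 hlt hlam n seq j
    (fun n => by simp [hseq]) (by simp [hseq]) (by simp [hseq]) (by simp [hseq])
    (digitSum_eq_of_tsum_smul_eq h0 hlt hp hsum)
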